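/- arXiv:1612.09055 — 3 statements merged into one kernel-verified Lean document; each statement's English description precedes it below -/
import Mathlib

section
/- Let t ≠ 0, ρ satisfy condition (M) in dimension n = 1, and μ^t_ε be the measure with density |e^{itΔ}√(ρ_ε)|². If f ∈ L^∞(ℝ) is such that the limits L₋(f) = lim_{x→−∞} f(x) and L₊(f) = lim_{x→+∞} f(x) both exist, then lim_{ε→0} ∫ f dμ^t_ε = (L₋(f) + L₊(f))/2. -/
open MeasureTheory Filter

noncomputable section

/-- One-dimensional free Schrödinger kernel. -/
def schrodingerKernel1 (t : ℝ) (x : ℝ) : ℂ :=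
  Complex.exp (-((x : ℂ)) ^ 2 / (4 * Complex.I * (t : ℂ))) /
    ((4 * (Real.pi : ℂ) * Complex.I * (t : ℂ)) ^ ((1 : ℂ) / 2))

/-- `u_ε(·,t) = e^{itΔ} √(ρ_ε)` in one dimension, `ρ_ε(x) = ε⁻¹ ρ(x/ε)`. -/
def uEps1 (ρ : ℝ → ℝ) (ε t x : ℝ) : ℂ :=
  ∫ y, schrodingerKernel1 t (x - y) * ((Real.sqrt (ε⁻¹ * ρ (y / ε)) : ℝ) : ℂ)

section AuxLemmas

open scoped FourierTransform SchwartzMap ContDiff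

lemma aux_fourier_continuous (g : ℝ → ℂ) (hg : Integrable g) : Continuous (𝓕 g : ℝ → ℂ) := by
  exact VectorFourier.fourierIntegral_continuous Real.continuous_fourierChar
    continuous_inner hg

lemma aux_fourier_ae (g : ℝ → ℂ) (hg : Integrable g) (hg2 : MemLp g 2) :
    ∀ᵐ x, (𝓕 (hg2.toLp g) : Lp ℂ 2 (volume : Measure ℝ)) x = (𝓕 g : ℝ → ℂ) x := by
  apply ae_eq_of_integral_contDiff_smul_eq
  · exact (Lp.memLp _).locallyIntegrable (by norm_num)
  · exact (aux_fourier_continuous g hg).locallyIntegrable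
  intro φ φ_smooth φ_cpt
  have hg₁ : HasCompactSupport (Complex.ofRealCLM ∘ φ) := φ_cpt.comp_left rfl
  have hg₂ : ContDiff ℝ ∞ (Complex.ofRealCLM ∘ φ) := by fun_prop
  set ψ : 𝓢(ℝ, ℂ) := hg₁.toSchwartzMap hg₂ with hψ
  have hψv : ∀ x, ψ x = (φ x : ℂ) := fun x => by simp [hψ]
  have h1 := congrArg (fun T => T ψ) (Lp.fourier_toTemperedDistribution_eq (hg2.toLp g))
  simp only [TemperedDistribution.fourier_apply, Lp.toTemperedDistribution_apply] at h1
  have h2 : ∫ x, (𝓕 ψ) x • (hg2.toLp g) x = ∫ x, (𝓕 ψ) x • g x := by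
    apply integral_congr_ae
    filter_upwards [hg2.coeFn_toLp] with x hx
    rw [hx]
  have h3 : ∫ x, (𝓕 ψ) x • g x = ∫ x, ψ x • (𝓕 g : ℝ → ℂ) x := by
    have := VectorFourier.integral_bilin_fourierIntegral_eq_flip (μ := volume) (ν := volume)
      (ContinuousLinearMap.lsmul ℂ ℂ)
      (L := innerₗ ℝ) Real.continuous_fourierChar continuous_inner ψ.integrable hg
    simpa using! this
  have h4 := h1.symm.trans (h2.trans h3)
  simpa [hψv] using h4

lemma aux_plancherel (g : ℝ → ℂ) (hg : Integrable g) (hg2 : MemLp g 2) :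
    Integrable (fun w => ‖(𝓕 g : ℝ → ℂ) w‖ ^ 2) ∧
    ∫ w, ‖(𝓕 g : ℝ → ℂ) w‖ ^ 2 = ∫ x, ‖g x‖ ^ 2 := by
  have hae := aux_fourier_ae g hg hg2
  have hF : MemLp (𝓕 g : ℝ → ℂ) 2 := (memLp_congr_ae hae).1 (Lp.memLp _)
  refine ⟨hF.integrable_norm_pow (by norm_num), ?_⟩
  have key : ∀ (h : ℝ → ℂ) (hh : MemLp h 2), ∫ x, ‖h x‖ ^ 2 = ‖hh.toLp h‖ ^ 2 := by
    intro h hh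
    have h1 := L2.inner_def (𝕜 := ℂ) (hh.toLp h) (hh.toLp h)
    rw [inner_self_eq_norm_sq_to_K] at h1
    have h2 : ∫ a, inner ℂ ((hh.toLp h) a) ((hh.toLp h) a) = ((∫ x, ‖h x‖ ^ 2 : ℝ) : ℂ) := by
      rw [← integral_complex_ofReal]
      apply integral_congr_ae
      filter_upwards [hh.coeFn_toLp] with x hx
      rw [hx, inner_self_eq_norm_sq_to_K]
      simp
    rw [h2] at h1
    exact Complex.ofReal_injective (by simpa using h1.symm)
  rw [key _ hF, key _ hg2, ← Lp.norm_fourier_eq (hg2.toLp g)]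
  congr 2
  apply Lp.ext
  filter_upwards [hae, hF.coeFn_toLp] with x h1 h2
  rw [h1, h2]

/-- the rescaled profile -/
def auxG (ρ : ℝ → ℝ) (t ε z : ℝ) : ℂ :=
  Complex.exp (((ε ^ 2 * z ^ 2 / (4 * t) : ℝ) : ℂ) * Complex.I) * ((Real.sqrt (ρ z) : ℝ) : ℂ)

lemma auxG_norm (ρ : ℝ → ℝ) (t ε z : ℝ) : ‖auxG ρ t ε z‖ = Real.sqrt (ρ z) := by
  rw [auxG, norm_mul, Complex.norm_exp_ofReal_mul_I, one_mul, Complex.norm_real,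
    Real.norm_of_nonneg (Real.sqrt_nonneg _)]

lemma auxG_meas (ρ : ℝ → ℝ) (hsqrt_int : Integrable (fun x => Real.sqrt (ρ x))) (t ε : ℝ) :
    AEStronglyMeasurable (auxG ρ t ε) volume := by
  unfold auxG
  refine AEStronglyMeasurable.mul (Continuous.aestronglyMeasurable (by fun_prop)) ?_
  exact Complex.continuous_ofReal.comp_aestronglyMeasurable hsqrt_int.1

lemma auxG_int (ρ : ℝ → ℝ) (hsqrt_int : Integrable (fun x => Real.sqrt (ρ x))) (t ε : ℝ) :
    Integrable (auxG ρ t ε) := by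
  refine hsqrt_int.mono' (auxG_meas ρ hsqrt_int t ε) (ae_of_all _ fun z => ?_)
  rw [auxG_norm]

lemma auxG_L2 (ρ : ℝ → ℝ) (hρ_int : Integrable ρ) (hρ_nonneg : ∀ x, 0 ≤ ρ x)
    (hsqrt_int : Integrable (fun x => Real.sqrt (ρ x))) (t ε : ℝ) :
    MemLp (auxG ρ t ε) 2 := by
  rw [memLp_two_iff_integrable_sq_norm (auxG_meas ρ hsqrt_int t ε)]
  simpa only [auxG_norm, Real.sq_sqrt (hρ_nonneg _)] using hρ_int

/-- density in frequency space -/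
def auxA (ρ : ℝ → ℝ) (t ε w : ℝ) : ℝ := ‖(𝓕 (auxG ρ t ε) : ℝ → ℂ) w‖ ^ 2

lemma auxA_tendsto (ρ : ℝ → ℝ)
    (hsqrt_int : Integrable (fun x => Real.sqrt (ρ x))) (t w : ℝ) :
    Tendsto (fun ε => auxA ρ t ε w) (nhds 0) (nhds (auxA ρ t 0 w)) := by
  unfold auxA
  refine Tendsto.pow (Tendsto.norm ?_) 2
  simp only [Real.fourier_real_eq_integral_exp_smul]
  refine tendsto_integral_filter_of_dominated_convergence (fun z => Real.sqrt (ρ z)) ?_ ?_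
    hsqrt_int ?_
  · refine Eventually.of_forall fun ε => ?_
    have hc : Continuous fun z : ℝ =>
        Complex.exp (((-2 * Real.pi * z * w : ℝ) : ℂ) * Complex.I) := by fun_prop
    exact hc.aestronglyMeasurable.smul (auxG_meas ρ hsqrt_int t ε)
  · refine Eventually.of_forall fun ε => ae_of_all _ fun z => ?_
    rw [norm_smul, Complex.norm_exp_ofReal_mul_I, one_mul, auxG_norm]
  · refine ae_of_all _ fun z => ?_
    have : Continuous fun ε : ℝ =>
        Complex.exp (((-2 * Real.pi * z * w : ℝ) : ℂ) * Complex.I) • auxG ρ t ε z := by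
      unfold auxG; fun_prop
    exact this.tendsto 0

lemma auxA_even (ρ : ℝ → ℝ) (t w : ℝ) : auxA ρ t 0 (-w) = auxA ρ t 0 w := by
  unfold auxA
  congr 1
  rw [← Complex.norm_conj ((𝓕 (auxG ρ t 0) : ℝ → ℂ) w)]
  congr 1
  simp only [Real.fourier_real_eq_integral_exp_smul]
  rw [← integral_conj]
  congr 1
  ext z
  simp only [auxG, smul_eq_mul, map_mul, ← Complex.exp_conj, Complex.conj_ofReal, Complex.conj_I]
  congr 2
  · push_cast; ring
  · simp

lemma auxU (ρ : ℝ → ℝ) (t : ℝ) (ht : t ≠ 0) (ε : ℝ) (hε : 0 < ε) (x : ℝ) :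
    ‖uEps1 ρ ε t x‖ ^ 2 = |ε / (4 * Real.pi * t)| * auxA ρ t ε (ε / (4 * Real.pi * t) * x) := by
  set D : ℂ := (4 * (Real.pi : ℂ) * Complex.I * (t : ℂ)) ^ ((1 : ℂ) / 2) with hD
  have hπ : Real.pi ≠ 0 := Real.pi_ne_zero
  have hD2 : ‖D‖ ^ 2 = 4 * Real.pi * |t| := by
    have : D ^ 2 = 4 * (Real.pi : ℂ) * Complex.I * (t : ℂ) := by
      rw [hD, ← Complex.cpow_nat_mul]; norm_num
    rw [← norm_pow, this]
    simp [abs_of_pos Real.pi_pos]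
  have hu : uEps1 ρ ε t x = (ε : ℂ) * ((Complex.exp (((x ^ 2 / (4 * t) : ℝ) : ℂ) * Complex.I) / D *
      ((Real.sqrt ε⁻¹ : ℝ) : ℂ)) * (𝓕 (auxG ρ t ε) : ℝ → ℂ) (ε / (4 * Real.pi * t) * x)) := by
    have h1 := Measure.integral_comp_div (fun z : ℝ => schrodingerKernel1 t (x - ε * z) *
      ((Real.sqrt (ε⁻¹ * ρ z) : ℝ) : ℂ)) ε
    rw [Real.fourier_real_eq_integral_exp_smul, ← integral_const_mul]
    have h2 : uEps1 ρ ε t x = ∫ y : ℝ, (fun z : ℝ => schrodingerKernel1 t (x - ε * z) *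
      ((Real.sqrt (ε⁻¹ * ρ z) : ℝ) : ℂ)) (y / ε) := by
      unfold uEps1
      congr 1
      ext y
      simp only [mul_div_cancel₀ y hε.ne']
    rw [h2, h1, abs_of_pos hε, Complex.real_smul]
    congr 2
    ext z
    rw [Real.sqrt_mul (inv_nonneg.2 hε.le)]
    simp only [schrodingerKernel1, auxG, smul_eq_mul, ← hD]
    have hexp : Complex.exp (-((x - ε * z : ℝ) : ℂ) ^ 2 / (4 * Complex.I * (t : ℂ))) =
        Complex.exp (((x ^ 2 / (4 * t) : ℝ) : ℂ) * Complex.I) *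
        Complex.exp (((-2 * Real.pi * z * (ε / (4 * Real.pi * t) * x) : ℝ) : ℂ) * Complex.I) *
        Complex.exp (((ε ^ 2 * z ^ 2 / (4 * t) : ℝ) : ℂ) * Complex.I) := by
      rw [← Complex.exp_add, ← Complex.exp_add]
      congr 1
      have ht' : (t : ℂ) ≠ 0 := by exact_mod_cast ht
      have hπ' : (Real.pi : ℂ) ≠ 0 := by exact_mod_cast hπ
      push_cast
      field_simp
      rw [Complex.I_sq]
      ring
    rw [hexp]
    push_cast
    ring
  rw [hu]
  simp only [norm_mul, norm_div, Complex.norm_exp_ofReal_mul_I, Complex.norm_real, mul_pow,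
    div_pow, hD2, auxA, Real.norm_of_nonneg (Real.sqrt_nonneg _),
    Real.sq_sqrt (inv_nonneg.2 hε.le), Real.norm_of_nonneg hε.le, abs_div, abs_mul,
    abs_of_pos Real.pi_pos, abs_of_pos hε]
  have : |t| ≠ 0 := abs_ne_zero.2 ht
  norm_num
  field_simp

end AuxLemmas

/-- if `f ∈ L^∞(ℝ)` has limits `L₋, L₊` at `∓∞`, then
`∫ f dμ^t_ε → (L₋ + L₊)/2` as `ε → 0`, where `dμ^t_ε = |e^{itΔ}√(ρ_ε)|² dx`. -/
theorem limit_on_functions_with_limits_at_infinity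
    (ρ : ℝ → ℝ)
    (hρ_int : Integrable ρ) (hρ_nonneg : ∀ x, 0 ≤ ρ x)
    (hsqrt_int : Integrable (fun x => Real.sqrt (ρ x)))
    (hρ_one : ∫ x, ρ x = 1)
    (t : ℝ) (ht : t ≠ 0)
    (f : ℝ → ℝ) (hf_meas : Measurable f) (C : ℝ) (hf_bd : ∀ x, |f x| ≤ C)
    (Lm Lp : ℝ)
    (hLm : Tendsto f atBot (nhds Lm)) (hLp : Tendsto f atTop (nhds Lp)) :
    Tendsto (fun ε : ℝ => ∫ x, f x * ‖uEps1 ρ ε t x‖ ^ 2)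
      (nhdsWithin 0 (Set.Ioi 0)) (nhds ((Lm + Lp) / 2)) := by
  have hA_int : ∀ ε, Integrable (auxA ρ t ε) := fun ε =>
    (aux_plancherel _ (auxG_int ρ hsqrt_int t ε) (auxG_L2 ρ hρ_int hρ_nonneg hsqrt_int t ε)).1
  have hA_one : ∀ ε, ∫ w, auxA ρ t ε w = 1 := fun ε => by
    have := (aux_plancherel _ (auxG_int ρ hsqrt_int t ε)
      (auxG_L2 ρ hρ_int hρ_nonneg hsqrt_int t ε)).2
    simp only [auxG_norm, Real.sq_sqrt (hρ_nonneg _), hρ_one] at this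
    exact this
  have hA_nn : ∀ ε w, 0 ≤ auxA ρ t ε w := fun ε w => by unfold auxA; positivity
  have hπ := Real.pi_pos
  set c : ℝ := 4 * Real.pi * t with hc
  have hc0 : c ≠ 0 := by positivity
  have hC : 0 ≤ C := (abs_nonneg _).trans (hf_bd 0)
  -- change of variables
  have hcv : ∀ ε : ℝ, 0 < ε → ∫ x, f x * ‖uEps1 ρ ε t x‖ ^ 2 =
      ∫ w, f (c / ε * w) * auxA ρ t ε w := by
    intro ε hε
    have h1 := Measure.integral_comp_mul_left (fun w => f (c / ε * w) * auxA ρ t ε w) (ε / c)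
    have h2 : ∀ x, f x * ‖uEps1 ρ ε t x‖ ^ 2 =
        |ε / c| * (f (c / ε * (ε / c * x)) * auxA ρ t ε (ε / c * x)) := by
      intro x
      rw [auxU ρ t ht ε hε x, ← hc]
      have : c / ε * (ε / c * x) = x := by field_simp
      rw [this]; ring
    simp_rw [h2]
    rw [integral_const_mul, h1, smul_eq_mul, ← mul_assoc, ← abs_mul,
      mul_inv_cancel₀ (by positivity), abs_one, one_mul]
  -- Scheffé
  have hsch : Tendsto (fun ε => ∫ w, |auxA ρ t ε w - auxA ρ t 0 w|) (nhds 0) (nhds 0) := by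
    have hmin : Tendsto (fun ε => ∫ w, min (auxA ρ t ε w) (auxA ρ t 0 w)) (nhds 0)
        (nhds (∫ w, auxA ρ t 0 w)) := by
      refine tendsto_integral_filter_of_dominated_convergence (auxA ρ t 0) ?_ ?_ (hA_int 0) ?_
      · exact Eventually.of_forall fun ε => ((hA_int ε).inf (hA_int 0)).1
      · refine Eventually.of_forall fun ε => ae_of_all _ fun w => ?_
        rw [Real.norm_of_nonneg (le_min (hA_nn _ _) (hA_nn _ _))]
        exact min_le_right _ _
      · refine ae_of_all _ fun w => ?_
        have := (auxA_tendsto ρ hsqrt_int t w).min (tendsto_const_nhds (x := auxA ρ t 0 w))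
        rwa [min_self] at this
    have heq : ∀ ε, ∫ w, |auxA ρ t ε w - auxA ρ t 0 w| =
        2 - 2 * ∫ w, min (auxA ρ t ε w) (auxA ρ t 0 w) := by
      intro ε
      have h1 : ∀ w, |auxA ρ t ε w - auxA ρ t 0 w| =
          (auxA ρ t ε w + auxA ρ t 0 w) - 2 * min (auxA ρ t ε w) (auxA ρ t 0 w) := by
        intro w
        rcases le_total (auxA ρ t ε w) (auxA ρ t 0 w) with h | h
        · rw [min_eq_left h, abs_of_nonpos (by linarith)]; ring
        · rw [min_eq_right h, abs_of_nonneg (by linarith)]; ring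
      simp_rw [h1]
      have j1 : Integrable (fun w => auxA ρ t ε w + auxA ρ t 0 w) := (hA_int ε).add (hA_int 0)
      have j2 : Integrable (fun w => 2 * min (auxA ρ t ε w) (auxA ρ t 0 w)) :=
        ((hA_int ε).inf (hA_int 0)).const_mul 2
      rw [integral_sub j1 j2,
        integral_add (hA_int ε) (hA_int 0), integral_const_mul, hA_one, hA_one]
      norm_num
    simp_rw [heq]
    have := (hmin.const_mul 2).const_sub 2
    rw [hA_one] at this
    simpa using this
  have hfA : ∀ ε δ, Integrable (fun w => f (c / ε * w) * auxA ρ t δ w) := fun ε δ =>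
    (hA_int δ).bdd_mul (c := C) (hf_meas.comp (measurable_const_mul _)).aestronglyMeasurable
      (ae_of_all _ fun w => hf_bd _)
  have hdiff : Tendsto (fun ε => (∫ w, f (c / ε * w) * auxA ρ t ε w) -
      ∫ w, f (c / ε * w) * auxA ρ t 0 w) (nhdsWithin 0 (Set.Ioi 0)) (nhds 0) := by
    have hb := (hsch.const_mul C).mono_left (nhdsWithin_le_nhds (s := Set.Ioi 0))
    rw [mul_zero] at hb
    refine squeeze_zero_norm (fun ε => ?_) hb
    rw [← integral_sub (hfA ε ε) (hfA ε 0), ← integral_const_mul]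
    refine norm_integral_le_of_norm_le (((hA_int ε).sub (hA_int 0)).abs.const_mul C)
      (ae_of_all _ fun w => ?_)
    rw [← mul_sub, norm_mul]
    exact mul_le_mul_of_nonneg_right (hf_bd _) (abs_nonneg _)
  -- limit profile
  let h : ℝ → ℝ := fun w => if 0 < c * w then Lp else Lm
  have hmain : Tendsto (fun ε => ∫ w, f (c / ε * w) * auxA ρ t 0 w)
      (nhdsWithin 0 (Set.Ioi 0)) (nhds (∫ w, h w * auxA ρ t 0 w)) := by
    refine tendsto_integral_filter_of_dominated_convergence (fun w => C * auxA ρ t 0 w) ?_ ?_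
      ((hA_int 0).const_mul C) ?_
    · exact Eventually.of_forall fun ε => (hfA ε 0).1
    · refine Eventually.of_forall fun ε => ae_of_all _ fun w => ?_
      rw [norm_mul, Real.norm_of_nonneg (hA_nn 0 w)]
      exact mul_le_mul_of_nonneg_right (hf_bd _) (hA_nn _ _)
    · filter_upwards [Measure.ae_ne volume (0 : ℝ)] with w hw
      refine Tendsto.mul_const _ ?_
      have hcw : c * w ≠ 0 := mul_ne_zero hc0 hw
      have he : ∀ ε : ℝ, c / ε * w = (c * w) * ε⁻¹ := fun ε => by ring
      simp_rw [he]
      rcases lt_or_gt_of_ne hcw with hn | hp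
      · simp only [h, if_neg (not_lt.2 hn.le)]
        exact hLm.comp (tendsto_inv_nhdsGT_zero.const_mul_atTop_of_neg hn)
      · simp only [h, if_pos hp]
        exact hLp.comp (tendsto_inv_nhdsGT_zero.const_mul_atTop hp)
  have hval : ∫ w, h w * auxA ρ t 0 w = (Lm + Lp) / 2 := by
    have hhm : Measurable h :=
      Measurable.ite (measurableSet_lt measurable_const (measurable_const_mul c))
        measurable_const measurable_const
    have hhb : ∀ w, ‖h w‖ ≤ |Lp| + |Lm| := by
      intro w
      simp only [h, Real.norm_eq_abs]
      split_ifs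
      · linarith [abs_nonneg Lm]
      · linarith [abs_nonneg Lp]
    have i1 : Integrable (fun w => h w * auxA ρ t 0 w) :=
      (hA_int 0).bdd_mul hhm.aestronglyMeasurable (ae_of_all _ hhb)
    have i2 : Integrable (fun w => h (-w) * auxA ρ t 0 w) :=
      (hA_int 0).bdd_mul (hhm.comp measurable_neg).aestronglyMeasurable
        (ae_of_all _ fun w => hhb (-w))
    have e1 : ∫ w, h (-w) * auxA ρ t 0 w = ∫ w, h w * auxA ρ t 0 w := by
      rw [← integral_neg_eq_self (fun w => h w * auxA ρ t 0 w)]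
      simp only [auxA_even]
    have e2 : (∫ w, h w * auxA ρ t 0 w) + ∫ w, h (-w) * auxA ρ t 0 w = Lm + Lp := by
      rw [← integral_add i1 i2]
      have : ∫ w, (Lm + Lp) * auxA ρ t 0 w = Lm + Lp := by
        rw [integral_const_mul, hA_one, mul_one]
      rw [← this]
      apply integral_congr_ae
      filter_upwards [Measure.ae_ne volume (0 : ℝ)] with w hw
      have hcw : c * w ≠ 0 := mul_ne_zero hc0 hw
      rcases lt_or_gt_of_ne hcw with hn | hp
      · have : 0 < c * -w := by linarith
        simp only [h, if_neg (not_lt.2 hn.le), if_pos this]; ring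
      · have : ¬ 0 < c * -w := by linarith
        simp only [h, if_pos hp, if_neg this]; ring
    linarith
  rw [← hval]
  have hsum := hdiff.add hmain
  rw [zero_add] at hsum
  refine hsum.congr' ?_
  filter_upwards [self_mem_nhdsWithin] with ε hε
  rw [hcv ε hε]; ring
end
end

section
/- Let t ≠ 0, ρ satisfy condition (M) on ℝ, and μ^t_ε be the probability measure with density |e^{itΔ}√(ρ_ε)|². Then for every ξ ∈ ℝ \ {0}, ∫ e^{ixξ} dμ^t_ε(x) → 0 as ε → 0; indeed |⟨μ^t_ε, e^{i·ξ}⟩| ≤ (√ρ * R√ρ)(2tξ/ε) → 0, where Rg(x) = g(−x). -/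
open MeasureTheory Filter

noncomputable section

section Aux

open scoped FourierTransform ComplexConjugate

theorem aux_fourier_ae_s9 (f : ℝ → ℂ) (h1 : Integrable f) (h2 : MemLp f 2) :
    (((𝓕 (h2.toLp f) : Lp (α := ℝ) ℂ 2)) : ℝ → ℂ) =ᵐ[volume] 𝓕 f := by
  have hc : Continuous (𝓕 f) := 
    VectorFourier.fourierIntegral_continuous Real.continuous_fourierChar continuous_inner h1
  apply ae_eq_of_integral_contDiff_smul_eq
  · exact (Lp.memLp _).locallyIntegrable (by norm_num)
  · exact hc.locallyIntegrable
  · intro g g_smooth g_cpt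
    have hg₁ : HasCompactSupport (Complex.ofRealCLM ∘ g) := g_cpt.comp_left rfl
    have hg₂ : ContDiff ℝ (⊤ : ℕ∞) (Complex.ofRealCLM ∘ g) := by fun_prop
    set G := hg₁.toSchwartzMap hg₂ with hG
    have hGg : ∀ x, G x = (g x : ℂ) := fun x => by simp [hG]
    calc ∫ x, g x • (((𝓕 (h2.toLp f) : Lp (α := ℝ) ℂ 2 volume)) : ℝ → ℂ) x
        = Lp.toTemperedDistribution (𝓕 (h2.toLp f) : Lp (α := ℝ) ℂ 2 volume) G := by
          rw [Lp.toTemperedDistribution_apply]; simp [hGg]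
      _ = Lp.toTemperedDistribution (h2.toLp f) (𝓕 G) := by
          rw [← Lp.fourier_toTemperedDistribution_eq, TemperedDistribution.fourier_apply]
      _ = ∫ x, (𝓕 G) x • f x := by
          rw [Lp.toTemperedDistribution_apply]
          apply integral_congr_ae
          filter_upwards [h2.coeFn_toLp] with x hx
          rw [hx]
      _ = ∫ x, G x • 𝓕 f x := by
          rw [SchwartzMap.fourier_coe]
          simpa using! VectorFourier.integral_fourierIntegral_smul_eq_flip (L := innerₗ ℝ)
            Real.continuous_fourierChar continuous_inner G.integrable h1
      _ = ∫ x, g x • 𝓕 f x := by simp [hGg]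

theorem aux_fourier_memLp (f : ℝ → ℂ) (h1 : Integrable f) (h2 : MemLp f 2) :
    MemLp (𝓕 f) 2 := (memLp_congr_ae (aux_fourier_ae_s9 f h1 h2)).1 (Lp.memLp _)

theorem aux_plancherel_s9 (f g : ℝ → ℂ) (h1 : Integrable f) (h2 : MemLp f 2)
    (g1 : Integrable g) (g2 : MemLp g 2) :
    ∫ w, 𝓕 g w * conj (𝓕 f w) = ∫ x, g x * conj (f x) := by
  have := Lp.inner_fourier_eq (h2.toLp f) (g2.toLp g)
  rw [L2.inner_def, L2.inner_def] at this
  convert! this using 1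
  · apply integral_congr_ae
    filter_upwards [aux_fourier_ae_s9 f h1 h2, aux_fourier_ae_s9 g g1 g2] with x hx hy
    rw [hx, hy]; simp
  · apply integral_congr_ae
    filter_upwards [h2.coeFn_toLp, g2.coeFn_toLp] with x hx hy
    rw [hx, hy]; simp

theorem aux_fourier_shift (f : ℝ → ℂ) (a w : ℝ) :
    𝓕 (fun y => f (y + a)) w = Complex.exp (2 * Real.pi * Complex.I * w * a) * 𝓕 f w := by
  rw [Real.fourier_real_eq_integral_exp_smul, Real.fourier_real_eq_integral_exp_smul]
  rw [← integral_add_right_eq_self (fun v : ℝ =>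
    Complex.exp (((-2 * Real.pi * v * w : ℝ) : ℂ) * Complex.I) • f v) a, ← integral_const_mul]
  congr 1; ext y
  simp only [smul_eq_mul]
  rw [← mul_assoc, ← Complex.exp_add]
  congr 2
  push_cast; ring

theorem aux_key (f : ℝ → ℂ) (h1 : Integrable f) (h2 : MemLp f 2) (a : ℝ) :
    ∫ w : ℝ, Complex.exp (2 * Real.pi * Complex.I * w * a) * ((‖𝓕 f w‖ ^ 2 : ℝ) : ℂ)
      = ∫ y, f (y + a) * conj (f y) := by
  rw [← aux_plancherel_s9 f (fun y => f (y + a)) h1 h2 (h1.comp_add_right a)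
    (h2.comp_measurePreserving (measurePreserving_add_right volume a))]
  congr 1; ext w
  rw [aux_fourier_shift, mul_assoc _ (𝓕 f w), Complex.mul_conj, Complex.normSq_eq_norm_sq]

theorem aux_tendsto (f : ℝ → ℂ) (h1 : Integrable f) (h2 : MemLp f 2) :
    Tendsto (fun a : ℝ => ∫ y, f (y + a) * conj (f y)) (cocompact ℝ) (nhds 0) := by
  have h := (Real.zero_at_infty_fourier (fun w => ((‖𝓕 f w‖ ^ 2 : ℝ) : ℂ))).comp
    (Homeomorph.neg ℝ).isClosedEmbedding.tendsto_cocompact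
  refine h.congr fun a => ?_
  rw [← aux_key f h1 h2]
  simp only [Function.comp, Homeomorph.coe_neg]
  rw [Real.fourier_real_eq_integral_exp_smul]
  congr 1; ext w
  rw [smul_eq_mul]
  congr 2
  push_cast; ring

theorem aux_kernel (t : ℝ) :
    ‖(4 * (Real.pi : ℂ) * Complex.I * (t : ℂ)) ^ ((1 : ℂ) / 2)‖ ^ 2 = 4 * Real.pi * |t| := by
  rw [← norm_pow, ← Complex.cpow_nat_mul]
  simp [abs_of_pos Real.pi_pos]

theorem aux_u (ρ : ℝ → ℝ) (ε t : ℝ) (ht : t ≠ 0) (x : ℝ) :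
    ‖uEps1 ρ ε t x‖ ^ 2 = (4 * Real.pi * |t|)⁻¹ *
      ‖𝓕 (fun y : ℝ => Complex.exp (((y ^ 2 / (4 * t) : ℝ) : ℂ) * Complex.I) *
        ((Real.sqrt (ε⁻¹ * ρ (y / ε)) : ℝ) : ℂ)) (x / (4 * Real.pi * t))‖ ^ 2 := by
  have htc : (t : ℂ) ≠ 0 := by exact_mod_cast ht
  have hpi : (Real.pi : ℂ) ≠ 0 := by exact_mod_cast Real.pi_ne_zero
  have h : uEps1 ρ ε t x = ((4 * (Real.pi : ℂ) * Complex.I * (t : ℂ)) ^ ((1 : ℂ) / 2))⁻¹ *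
      (Complex.exp (((x ^ 2 / (4 * t) : ℝ) : ℂ) * Complex.I) *
      𝓕 (fun y : ℝ => Complex.exp (((y ^ 2 / (4 * t) : ℝ) : ℂ) * Complex.I) *
        ((Real.sqrt (ε⁻¹ * ρ (y / ε)) : ℝ) : ℂ)) (x / (4 * Real.pi * t))) := by
    rw [Real.fourier_real_eq_integral_exp_smul, uEps1, ← integral_const_mul, ← integral_const_mul]
    congr 1; ext y
    rw [schrodingerKernel1, smul_eq_mul, div_eq_inv_mul, mul_assoc, ← mul_assoc (Complex.exp _),
      ← mul_assoc (_ * _) (Complex.exp _), ← Complex.exp_add, ← Complex.exp_add]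
    congr 3
    push_cast
    field_simp
    rw [Complex.I_sq]
    ring
  rw [h, norm_mul, norm_mul, Complex.norm_exp_ofReal_mul_I, one_mul, mul_pow, norm_inv, inv_pow,
    aux_kernel]

theorem aux_integral (ρ : ℝ → ℝ) (ε t ξ : ℝ) (ht : t ≠ 0) :
    ∫ x : ℝ, Complex.exp (Complex.I * x * ξ) * ((‖uEps1 ρ ε t x‖ ^ 2 : ℝ) : ℂ) =
    ∫ w : ℝ, Complex.exp (2 * Real.pi * Complex.I * w * ((2 * t * ξ : ℝ) : ℂ)) *
      ((‖𝓕 (fun y : ℝ => Complex.exp (((y ^ 2 / (4 * t) : ℝ) : ℂ) * Complex.I) *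
        ((Real.sqrt (ε⁻¹ * ρ (y / ε)) : ℝ) : ℂ)) w‖ ^ 2 : ℝ) : ℂ) := by
  have htc : (t : ℂ) ≠ 0 := by exact_mod_cast ht
  have hpi : (Real.pi : ℂ) ≠ 0 := by exact_mod_cast Real.pi_ne_zero
  set F : ℝ → ℂ := fun w : ℝ => Complex.exp (2 * Real.pi * Complex.I * w * ((2 * t * ξ : ℝ) : ℂ)) *
      ((‖𝓕 (fun y : ℝ => Complex.exp (((y ^ 2 / (4 * t) : ℝ) : ℂ) * Complex.I) *
        ((Real.sqrt (ε⁻¹ * ρ (y / ε)) : ℝ) : ℂ)) w‖ ^ 2 : ℝ) : ℂ) with hF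
  have h := Measure.integral_comp_div F (4 * Real.pi * t)
  have habs : |4 * Real.pi * t| = 4 * Real.pi * |t| := by
    rw [abs_mul, abs_of_pos (by positivity)]
  have hpos : (4 * Real.pi * |t|) ≠ 0 := by positivity
  have : ∫ w, F w = (4 * Real.pi * |t|)⁻¹ • ∫ x, F (x / (4 * Real.pi * t)) := by
    rw [h, habs, smul_smul, inv_mul_cancel₀ hpos, one_smul]
  rw [this, ← integral_smul]
  congr 1; ext x
  rw [aux_u ρ ε t ht x, hF]
  simp only [Complex.real_smul]
  rw [Complex.ofReal_mul, mul_left_comm]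
  congr 3
  push_cast
  field_simp
  norm_num

theorem aux_bound (ρ : ℝ → ℝ) (hρ_int : Integrable ρ) (hρ_nonneg : ∀ x, 0 ≤ ρ x)
    (hsqrt_int : Integrable (fun x => Real.sqrt (ρ x)))
    (t : ℝ) (ht : t ≠ 0) (ξ : ℝ) (ε : ℝ) (hε : 0 < ε) :
    ‖∫ x : ℝ, Complex.exp (Complex.I * x * ξ) * ((‖uEps1 ρ ε t x‖ ^ 2 : ℝ) : ℂ)‖ ≤
        ∫ y : ℝ, Real.sqrt (ρ (y + 2 * t * ξ / ε)) * Real.sqrt (ρ y) := by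
  have hcont : Continuous (fun y : ℝ => Complex.exp (((y ^ 2 / (4 * t) : ℝ) : ℂ) * Complex.I)) := by
    fun_prop
  have hfac : ∀ y, Real.sqrt (ε⁻¹ * ρ (y / ε)) = Real.sqrt ε⁻¹ * Real.sqrt (ρ (y / ε)) := fun y =>
    Real.sqrt_mul (by positivity) _
  have g1 : Integrable (fun y : ℝ => Real.sqrt (ε⁻¹ * ρ (y / ε))) := by
    simp only [hfac]
    exact (hsqrt_int.comp_div hε.ne').const_mul _
  have g2 : MemLp (fun y : ℝ => Real.sqrt (ε⁻¹ * ρ (y / ε))) 2 := by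
    rw [memLp_two_iff_integrable_sq g1.1]
    refine ((hρ_int.comp_div hε.ne').const_mul ε⁻¹).congr (Eventually.of_forall fun y => ?_)
    have := hρ_nonneg (y / ε)
    simp only
    rw [Real.sq_sqrt (by positivity)]
  have hnorm : ∀ y : ℝ, ‖Complex.exp (((y ^ 2 / (4 * t) : ℝ) : ℂ) * Complex.I) *
        ((Real.sqrt (ε⁻¹ * ρ (y / ε)) : ℝ) : ℂ)‖ = Real.sqrt (ε⁻¹ * ρ (y / ε)) := fun y => by
    rw [norm_mul, Complex.norm_exp_ofReal_mul_I, one_mul, Complex.norm_real,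
      Real.norm_of_nonneg (Real.sqrt_nonneg _)]
  have hmeas : AEStronglyMeasurable (fun y : ℝ =>
      Complex.exp (((y ^ 2 / (4 * t) : ℝ) : ℂ) * Complex.I) *
        ((Real.sqrt (ε⁻¹ * ρ (y / ε)) : ℝ) : ℂ)) :=
    hcont.aestronglyMeasurable.mul g1.ofReal.1
  have h1 := g1.mono' hmeas (Eventually.of_forall fun y => (hnorm y).le)
  have h2 := g2.of_le hmeas (Eventually.of_forall fun y =>
    (hnorm y).le.trans (le_abs_self _))
  rw [aux_integral ρ ε t ξ ht, aux_key _ h1 h2]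
  refine (norm_integral_le_integral_norm _).trans (le_of_eq ?_)
  have h := Measure.integral_comp_div
    (fun y => Real.sqrt (ρ (y + 2 * t * ξ / ε)) * Real.sqrt (ρ y)) ε
  have : ∫ y : ℝ, Real.sqrt (ρ (y + 2 * t * ξ / ε)) * Real.sqrt (ρ y) = ε⁻¹ •
      ∫ y : ℝ, Real.sqrt (ρ (y / ε + 2 * t * ξ / ε)) * Real.sqrt (ρ (y / ε)) := by
    rw [h, abs_of_pos hε, smul_smul, inv_mul_cancel₀ hε.ne', one_smul]
  rw [this, ← integral_smul]
  congr 1; ext y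
  rw [norm_mul, RCLike.norm_conj, hnorm, hnorm, hfac, hfac, smul_eq_mul, ← add_div]
  have := Real.mul_self_sqrt (inv_nonneg.2 hε.le)
  linear_combination Real.sqrt (ρ ((y + 2 * t * ξ) / ε)) * Real.sqrt (ρ (y / ε)) * this

theorem aux_limit (ρ : ℝ → ℝ) (hρ_int : Integrable ρ) (hρ_nonneg : ∀ x, 0 ≤ ρ x)
    (hsqrt_int : Integrable (fun x => Real.sqrt (ρ x)))
    (t : ℝ) (ht : t ≠ 0) (ξ : ℝ) (hξ : ξ ≠ 0) :
    Tendsto (fun ε : ℝ => ∫ y : ℝ, Real.sqrt (ρ (y + 2 * t * ξ / ε)) * Real.sqrt (ρ y))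
      (nhdsWithin 0 (Set.Ioi 0)) (nhds 0) := by
  have g2 : MemLp (fun y : ℝ => Real.sqrt (ρ y)) 2 := by
    rw [memLp_two_iff_integrable_sq hsqrt_int.1]
    exact hρ_int.congr (Eventually.of_forall fun y => (Real.sq_sqrt (hρ_nonneg y)).symm)
  have h := aux_tendsto (fun y => ((Real.sqrt (ρ y) : ℝ) : ℂ)) hsqrt_int.ofReal g2.ofReal
  have hc : 2 * t * ξ ≠ 0 := by positivity
  have ha : Tendsto (fun ε : ℝ => 2 * t * ξ / ε) (nhdsWithin 0 (Set.Ioi 0)) (cocompact ℝ) :=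
    (Homeomorph.mulLeft₀ _ hc).isClosedEmbedding.tendsto_cocompact.comp
      (tendsto_inv_nhdsGT_zero.mono_right atTop_le_cocompact)
  have h' := (Complex.continuous_re.tendsto 0).comp (h.comp ha)
  rw [Complex.zero_re] at h'
  refine h'.congr fun ε => ?_
  simp only [Function.comp, Complex.conj_ofReal, ← Complex.ofReal_mul]
  rw [integral_complex_ofReal, Complex.ofReal_re]

end Aux

/-- for every `ξ ≠ 0`, `∫ e^{ixξ} dμ^t_ε(x) → 0` as `ε → 0`; indeed its
modulus is bounded by `(√ρ * R√ρ)(2tξ/ε)`, where `Rg(x) = g(-x)`, and this tends to `0`. -/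
theorem characters_tend_to_zero
    (ρ : ℝ → ℝ)
    (hρ_int : Integrable ρ) (hρ_nonneg : ∀ x, 0 ≤ ρ x)
    (hsqrt_int : Integrable (fun x => Real.sqrt (ρ x)))
    (hρ_one : ∫ x, ρ x = 1)
    (t : ℝ) (ht : t ≠ 0) (ξ : ℝ) (hξ : ξ ≠ 0) :
    (∀ ε : ℝ, 0 < ε →
      ‖∫ x : ℝ, Complex.exp (Complex.I * x * ξ) * ((‖uEps1 ρ ε t x‖ ^ 2 : ℝ) : ℂ)‖ ≤
        ∫ y : ℝ, Real.sqrt (ρ (2 * t * ξ / ε - y)) * Real.sqrt (ρ (-y))) ∧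
    Tendsto (fun ε : ℝ => ∫ x : ℝ, Complex.exp (Complex.I * x * ξ) *
        ((‖uEps1 ρ ε t x‖ ^ 2 : ℝ) : ℂ))
      (nhdsWithin 0 (Set.Ioi 0)) (nhds 0) := by
  refine ⟨fun ε hε => ?_, ?_⟩
  · refine (aux_bound ρ hρ_int hρ_nonneg hsqrt_int t ht ξ ε hε).trans (le_of_eq ?_)
    rw [← integral_neg_eq_self]
    congr 1; ext y
    rw [neg_add_eq_sub]
  · refine squeeze_zero_norm' ?_ (aux_limit ρ hρ_int hρ_nonneg hsqrt_int t ht ξ hξ)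
    filter_upwards [self_mem_nhdsWithin] with ε hε
    exact aux_bound ρ hρ_int hρ_nonneg hsqrt_int t ht ξ ε hε
end
end

section
/- Let a ∈ ℝⁿ, t ≠ 0, ρ satisfy condition (M) on ℝⁿ, and let μ^t_ε be the probability measure with density |e^{itΔ}√(T_a ρ_ε)|², where T_a g(x) = g(x−a). Then for every ξ ∈ ℝⁿ \ {0}, the Fourier transform ℱ(μ^t_ε)(ξ) → 0 as ε → 0; in fact |ℱ(μ^t_ε)(ξ)| ≤ (√ρ * R√ρ)(−2tξ/ε) → 0. -/
open MeasureTheory Filter RealInnerProductSpace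

noncomputable section

/-- The free Schrödinger kernel on `ℝⁿ`. -/
def schrodingerKernel (n : ℕ) (t : ℝ) (x : EuclideanSpace ℝ (Fin n)) : ℂ :=
  Complex.exp (-((‖x‖ : ℂ)) ^ 2 / (4 * Complex.I * (t : ℂ))) /
    ((4 * (Real.pi : ℂ) * Complex.I * (t : ℂ)) ^ (((n : ℂ)) / 2))

/-- `u_ε(·,t) = e^{itΔ} √(T_a ρ_ε)` with `T_a g(x) = g(x - a)`, `ρ_ε(x) = ε^{-n}ρ(x/ε)`. -/
def uEpsShift (n : ℕ) (ρ : EuclideanSpace ℝ (Fin n) → ℝ) (a : EuclideanSpace ℝ (Fin n))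
    (ε t : ℝ) (x : EuclideanSpace ℝ (Fin n)) : ℂ :=
  ∫ y, schrodingerKernel n t (x - y) *
    ((Real.sqrt (ε ^ (-(n : ℝ)) * ρ (ε⁻¹ • (y - a))) : ℝ) : ℂ)

section Helpers

open scoped FourierTransform SchwartzMap ContDiff ComplexConjugate

/-- The `L²` Fourier transform agrees with the Fourier integral on `L¹ ∩ L²`. -/
lemma fourier_toLp_ae {n : ℕ} (g : EuclideanSpace ℝ (Fin n) → ℂ) (h1 : Integrable g)
    (h2 : MemLp g 2) :
    ⇑(𝓕 (h2.toLp g) : Lp ℂ 2 (volume : Measure (EuclideanSpace ℝ (Fin n)))) =ᵐ[volume] 𝓕 g := by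
  have hc : Continuous (𝓕 g) :=
    VectorFourier.fourierIntegral_continuous (L := innerₗ (EuclideanSpace ℝ (Fin n)))
      Real.continuous_fourierChar continuous_inner h1
  apply ae_eq_of_integral_contDiff_smul_eq
  · exact (Lp.memLp _).locallyIntegrable (by norm_num)
  · exact hc.locallyIntegrable
  · intro φ φs φc
    have hg₁ : HasCompactSupport (Complex.ofRealCLM ∘ φ) := φc.comp_left rfl
    have hg₂ : ContDiff ℝ ∞ (Complex.ofRealCLM ∘ φ) := by fun_prop
    set ψ : 𝓢(EuclideanSpace ℝ (Fin n), ℂ) := hg₁.toSchwartzMap hg₂ with hψ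
    have e1 := congrArg (fun T => T ψ) (Lp.fourier_toTemperedDistribution_eq (h2.toLp g))
    simp only [TemperedDistribution.fourier_apply, Lp.toTemperedDistribution_apply] at e1
    have e2 : ∫ x, (𝓕 ψ) x • (h2.toLp g) x = ∫ x, (𝓕 (ψ : _ → ℂ)) x • g x := by
      apply integral_congr_ae
      filter_upwards [h2.coeFn_toLp] with x hx
      rw [hx, SchwartzMap.fourier_coe]
    have e3 : ∫ x, (𝓕 (ψ : _ → ℂ)) x • g x = ∫ x, ψ x • 𝓕 g x := by
      simpa using! (VectorFourier.integral_fourierIntegral_smul_eq_flip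
        (L := innerₗ (EuclideanSpace ℝ (Fin n)))
        Real.continuous_fourierChar continuous_inner ψ.integrable h1)
    have e4 : ∀ x, ψ x = (φ x : ℂ) := fun x => rfl
    rw [e2, e3] at e1
    simp only [e4] at e1
    simpa using e1.symm

lemma fourier_shift {n : ℕ} (g : EuclideanSpace ℝ (Fin n) → ℂ) (v w : EuclideanSpace ℝ (Fin n)) :
    𝓕 (fun y => g (y + v)) w = Real.fourierChar ⟪v, w⟫ • 𝓕 g w :=
  congrFun (VectorFourier.fourierIntegral_comp_add_right Real.fourierChar volume
    (innerₗ (EuclideanSpace ℝ (Fin n))) g v) w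

/-- Wiener–Khinchin: the Fourier transform of `|ĝ|²` is the autocorrelation of `g`. -/
lemma fourier_normSq {n : ℕ} (g : EuclideanSpace ℝ (Fin n) → ℂ) (h1 : Integrable g)
    (h2 : MemLp g 2) (v : EuclideanSpace ℝ (Fin n)) :
    𝓕 (fun w => ((‖𝓕 g w‖ ^ 2 : ℝ) : ℂ)) v = ∫ y, g y * conj (g (y + v)) := by
  have h1' : Integrable (fun y => g (y + v)) := h1.comp_add_right v
  have h2' : MemLp (fun y => g (y + v)) 2 :=
    h2.comp_measurePreserving (measurePreserving_add_right volume v)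
  have key := Lp.inner_fourier_eq (h2'.toLp _) (h2.toLp g)
  rw [L2.inner_def, L2.inner_def] at key
  have eR : ∫ y, inner ℂ ((h2'.toLp _ : Lp ℂ 2 volume) y) ((h2.toLp g : Lp ℂ 2 volume) y)
      = ∫ y, g y * conj (g (y + v)) := by
    apply integral_congr_ae
    filter_upwards [h2.coeFn_toLp, h2'.coeFn_toLp] with y hy hy'
    rw [hy, hy']
    simp
  rw [← eR, ← key, Real.fourier_eq]
  apply integral_congr_ae
  filter_upwards [fourier_toLp_ae g h1 h2, fourier_toLp_ae _ h1' h2'] with w hw hw'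
  rw [hw, hw', fourier_shift, real_inner_comm]
  simp only [Circle.smul_def, smul_eq_mul, RCLike.inner_apply, map_mul]
  rw [AddChar.map_neg_eq_inv, Circle.coe_inv_eq_conj]
  push_cast
  rw [← Complex.mul_conj']
  ring

lemma memLp_two_of_sq {n : ℕ} (s : EuclideanSpace ℝ (Fin n) → ℝ) (h1 : Integrable s)
    (h2 : Integrable (fun x => s x ^ 2)) : MemLp s 2 :=
  (memLp_two_iff_integrable_sq h1.aestronglyMeasurable).2 h2

/-- Real autocorrelations of `L¹ ∩ L²` functions vanish at infinity. -/
lemma tendsto_corr {n : ℕ} (s : EuclideanSpace ℝ (Fin n) → ℝ) (h1 : Integrable s)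
    (h2 : MemLp s 2) :
    Tendsto (fun v => ∫ z, s z * s (z + v)) (cocompact (EuclideanSpace ℝ (Fin n))) (nhds 0) := by
  have hT := tendsto_integral_exp_inner_smul_cocompact
    (fun w => ((‖𝓕 (fun z => (s z : ℂ)) w‖ ^ 2 : ℝ) : ℂ))
  have e : ∀ v, ∫ w, Real.fourierChar (-⟪w, v⟫) •
      ((‖𝓕 (fun z => (s z : ℂ)) w‖ ^ 2 : ℝ) : ℂ) = ((∫ z, s z * s (z + v) : ℝ) : ℂ) := by
    intro v
    have := fourier_normSq (fun z => (s z : ℂ)) h1.ofReal h2.ofReal v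
    rw [Real.fourier_eq] at this
    rw [this, ← integral_complex_ofReal]
    simp
  simp only [e] at hT
  have hre := (Complex.continuous_re.tendsto 0).comp hT
  simpa [Function.comp_def] using hre

lemma uEpsShift_normSq (n : ℕ) (ρ : EuclideanSpace ℝ (Fin n) → ℝ) (a : EuclideanSpace ℝ (Fin n))
    (ε t : ℝ) (ht : t ≠ 0) (x : EuclideanSpace ℝ (Fin n)) :
    ‖uEpsShift n ρ a ε t x‖ ^ 2 = (|4 * Real.pi * t| ^ n)⁻¹ *
      ‖𝓕 (fun y => Complex.exp (((‖y‖ ^ 2 / (4 * t) : ℝ) : ℂ) * Complex.I) *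
        ((Real.sqrt (ε ^ (-(n : ℝ)) * ρ (ε⁻¹ • (y - a))) : ℝ) : ℂ))
        ((4 * Real.pi * t)⁻¹ • x)‖ ^ 2 := by
  have htc : (t : ℂ) ≠ 0 := by exact_mod_cast ht
  have hpi : (Real.pi : ℝ) ≠ 0 := Real.pi_ne_zero
  set K : ℂ := (4 * (Real.pi : ℂ) * Complex.I * (t : ℂ)) ^ (((n : ℂ)) / 2) with hK
  have hKn : ‖K‖ ^ 2 = |4 * Real.pi * t| ^ n := by
    have h0 : ((n : ℂ)) / 2 = (((n : ℝ) / 2 : ℝ) : ℂ) := by push_cast; rfl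
    rw [hK, h0, Complex.norm_cpow_real]
    have h1 : ‖4 * (Real.pi : ℂ) * Complex.I * (t : ℂ)‖ = |4 * Real.pi * t| := by
      simp [abs_mul]
    rw [h1, ← Real.rpow_natCast, ← Real.rpow_mul (abs_nonneg _), ← Real.rpow_natCast]
    congr 1
    push_cast
    ring
  have hu : uEpsShift n ρ a ε t x = (Complex.exp (((‖x‖ ^ 2 / (4 * t) : ℝ) : ℂ) * Complex.I) / K) *
      𝓕 (fun y => Complex.exp (((‖y‖ ^ 2 / (4 * t) : ℝ) : ℂ) * Complex.I) *
        ((Real.sqrt (ε ^ (-(n : ℝ)) * ρ (ε⁻¹ • (y - a))) : ℝ) : ℂ))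
        ((4 * Real.pi * t)⁻¹ • x) := by
    rw [Real.fourier_eq', uEpsShift, ← integral_const_mul]
    congr 1
    ext y
    rw [schrodingerKernel, ← hK, smul_eq_mul]
    have hexp : Complex.exp (-((‖x - y‖ : ℂ)) ^ 2 / (4 * Complex.I * (t : ℂ))) =
        Complex.exp (((‖x‖ ^ 2 / (4 * t) : ℝ) : ℂ) * Complex.I) *
        (Complex.exp (((-2 * Real.pi * ⟪y, (4 * Real.pi * t)⁻¹ • x⟫ : ℝ) : ℂ) * Complex.I) *
         Complex.exp (((‖y‖ ^ 2 / (4 * t) : ℝ) : ℂ) * Complex.I)) := by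
      rw [← Complex.exp_add, ← Complex.exp_add, ← add_mul, ← add_mul]
      congr 1
      have hr : ‖x‖ ^ 2 / (4 * t) + (-2 * Real.pi * ⟪y, (4 * Real.pi * t)⁻¹ • x⟫
          + ‖y‖ ^ 2 / (4 * t)) = ‖x - y‖ ^ 2 / (4 * t) := by
        rw [norm_sub_sq_real, real_inner_smul_right, real_inner_comm]
        field_simp
        ring
      rw [← Complex.ofReal_add, ← Complex.ofReal_add, hr]
      push_cast
      field_simp
      rw [Complex.I_sq]
      ring
    rw [hexp]
    ring
  rw [hu, norm_mul, norm_div, Complex.norm_exp_ofReal_mul_I, mul_pow, div_pow, hKn]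
  simp

lemma corr_scale {n : ℕ} (ρ : EuclideanSpace ℝ (Fin n) → ℝ) (a v : EuclideanSpace ℝ (Fin n))
    (ε : ℝ) (hε : 0 < ε) :
    ∫ y, Real.sqrt (ε ^ (-(n : ℝ)) * ρ (ε⁻¹ • (y - a))) *
      Real.sqrt (ε ^ (-(n : ℝ)) * ρ (ε⁻¹ • (y + v - a))) =
    ∫ z, Real.sqrt (ρ z) * Real.sqrt (ρ (z + ε⁻¹ • v)) := by
  have hp : 0 ≤ ε ^ (-(n : ℝ)) := by positivity
  have e : ∀ y, Real.sqrt (ε ^ (-(n : ℝ)) * ρ (ε⁻¹ • (y - a))) *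
      Real.sqrt (ε ^ (-(n : ℝ)) * ρ (ε⁻¹ • (y + v - a))) = ε ^ (-(n : ℝ)) *
      (fun y' => (fun z => Real.sqrt (ρ z) * Real.sqrt (ρ (z + ε⁻¹ • v))) (ε⁻¹ • y')) (y - a) := by
    intro y
    have : ε⁻¹ • (y + v - a) = ε⁻¹ • (y - a) + ε⁻¹ • v := by
      rw [← smul_add]; congr 1; abel
    rw [this, Real.sqrt_mul hp, Real.sqrt_mul hp]
    simp only
    rw [mul_mul_mul_comm, Real.mul_self_sqrt hp]
  simp_rw [e]
  rw [integral_const_mul, integral_sub_right_eq_self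
      (fun y' => (fun z => Real.sqrt (ρ z) * Real.sqrt (ρ (z + ε⁻¹ • v))) (ε⁻¹ • y')) a,
    Measure.integral_comp_inv_smul_of_nonneg volume
      (fun z => Real.sqrt (ρ z) * Real.sqrt (ρ (z + ε⁻¹ • v))) hε.le, finrank_euclideanSpace_fin, smul_eq_mul,
    ← mul_assoc, Real.rpow_neg hε.le, Real.rpow_natCast, inv_mul_cancel₀ (by positivity), one_mul]

lemma rhs_eq_corr {n : ℕ} (s : EuclideanSpace ℝ (Fin n) → ℝ) (v : EuclideanSpace ℝ (Fin n)) :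
    ∫ y, s (-v - y) * s (-y) = ∫ z, s z * s (z + v) := by
  rw [← integral_neg_eq_self, ← integral_add_right_eq_self _ v]
  congr 1
  ext y
  congr 2 <;> abel

lemma bound_aux
    (n : ℕ) (ρ : EuclideanSpace ℝ (Fin n) → ℝ)
    (hρ_int : Integrable ρ) (hρ_nonneg : ∀ x, 0 ≤ ρ x)
    (hsqrt_int : Integrable (fun x => Real.sqrt (ρ x)))
    (a : EuclideanSpace ℝ (Fin n)) (t : ℝ) (ht : t ≠ 0)
    (ξ : EuclideanSpace ℝ (Fin n)) (ε : ℝ) (hε : 0 < ε) :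
    ‖∫ x, Complex.exp (-Complex.I * (⟪x, ξ⟫ : ℝ)) *
          ((‖uEpsShift n ρ a ε t x‖ ^ 2 : ℝ) : ℂ)‖ ≤
        ∫ z, Real.sqrt (ρ z) * Real.sqrt (ρ (z + (2 * t / ε) • ξ)) := by
  have hp : 0 ≤ ε ^ (-(n : ℝ)) := by positivity
  set f : EuclideanSpace ℝ (Fin n) → ℝ :=
    fun y => Real.sqrt (ε ^ (-(n : ℝ)) * ρ (ε⁻¹ • (y - a))) with hf
  set g : EuclideanSpace ℝ (Fin n) → ℂ :=
    fun y => Complex.exp (((‖y‖ ^ 2 / (4 * t) : ℝ) : ℂ) * Complex.I) * (f y : ℂ) with hg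
  have hf1 : Integrable f := by
    have : f = fun y => Real.sqrt (ε ^ (-(n : ℝ))) *
        (fun y' => (fun z => Real.sqrt (ρ z)) (ε⁻¹ • y')) (y - a) := by
      ext y; simp only [hf]; rw [Real.sqrt_mul hp]
    rw [this]
    exact ((hsqrt_int.comp_smul (inv_ne_zero hε.ne')).comp_sub_right a).const_mul _
  have hf2 : MemLp f 2 := by
    apply memLp_two_of_sq f hf1
    have : (fun y => f y ^ 2) = fun y => ε ^ (-(n : ℝ)) *
        (fun y' => ρ (ε⁻¹ • y')) (y - a) := by
      ext y; simp only [hf]; rw [Real.sq_sqrt (mul_nonneg hp (hρ_nonneg _))]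
    rw [this]
    exact ((hρ_int.comp_smul (inv_ne_zero hε.ne')).comp_sub_right a).const_mul _
  have hgn : ∀ y, ‖g y‖ = f y := by
    intro y
    simp only [hg]
    rw [norm_mul, Complex.norm_exp_ofReal_mul_I, one_mul, Complex.norm_real, Real.norm_eq_abs,
      abs_of_nonneg (Real.sqrt_nonneg _)]
  have hgm : AEStronglyMeasurable g := by
    apply AEStronglyMeasurable.mul
    · apply Continuous.aestronglyMeasurable
      fun_prop
    · exact hf1.ofReal.aestronglyMeasurable
  have hg1 : Integrable g := hf1.mono hgm (by
    filter_upwards with y; rw [hgn]; exact le_abs_self _)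
  have hg2 : MemLp g 2 := hf2.mono hgm (by
    filter_upwards with y; rw [hgn]; exact le_abs_self _)
  have hT : 4 * Real.pi * t ≠ 0 := by
    have := Real.pi_ne_zero
    positivity
  have hval : ∫ x, Complex.exp (-Complex.I * (⟪x, ξ⟫ : ℝ)) *
          ((‖uEpsShift n ρ a ε t x‖ ^ 2 : ℝ) : ℂ) = ∫ y, g y * conj (g (y + (2 * t) • ξ)) := by
    rw [← fourier_normSq g hg1 hg2, Real.fourier_eq']
    have e : ∀ x, Complex.exp (-Complex.I * (⟪x, ξ⟫ : ℝ)) *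
          ((‖uEpsShift n ρ a ε t x‖ ^ 2 : ℝ) : ℂ) = (((|4 * Real.pi * t| ^ n)⁻¹ : ℝ) : ℂ) *
        (fun w => Complex.exp ((↑(-2 * Real.pi * ⟪w, (2 * t) • ξ⟫) * Complex.I)) •
          ((‖𝓕 g w‖ ^ 2 : ℝ) : ℂ)) ((4 * Real.pi * t)⁻¹ • x) := by
      intro x
      rw [uEpsShift_normSq n ρ a ε t ht x]
      have : (-2 * Real.pi * ⟪(4 * Real.pi * t)⁻¹ • x, (2 * t) • ξ⟫ : ℝ) = - ⟪x, ξ⟫ := by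
        rw [real_inner_smul_left, real_inner_smul_right]
        have := Real.pi_ne_zero
        field_simp
        ring
      simp only [this, smul_eq_mul]
      rw [Complex.ofReal_mul]
      have e2 : -Complex.I * ((⟪x, ξ⟫ : ℝ) : ℂ) = ((-⟪x, ξ⟫ : ℝ) : ℂ) * Complex.I := by
        push_cast; ring
      rw [e2]
      ring
    simp_rw [e]
    rw [integral_const_mul, Measure.integral_comp_inv_smul volume
      (fun w => Complex.exp ((↑(-2 * Real.pi * ⟪w, (2 * t) • ξ⟫) * Complex.I)) •
          ((‖𝓕 g w‖ ^ 2 : ℝ) : ℂ)) (4 * Real.pi * t),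
      finrank_euclideanSpace_fin, Complex.real_smul, ← mul_assoc, ← Complex.ofReal_mul, abs_pow,
      inv_mul_cancel₀ (by positivity), Complex.ofReal_one, one_mul]
  rw [hval]
  have hsc := corr_scale ρ a ((2 * t) • ξ) ε hε
  have hv : ε⁻¹ • (2 * t) • ξ = (2 * t / ε) • ξ := by
    rw [smul_smul]; congr 1; ring
  rw [hv] at hsc
  rw [← hsc]
  refine (norm_integral_le_integral_norm _).trans (le_of_eq ?_)
  congr 1
  ext y
  rw [norm_mul, RCLike.norm_conj, hgn, hgn]

lemma tendsto_smul_cocompact {n : ℕ} (ξ : EuclideanSpace ℝ (Fin n)) (hξ : ξ ≠ 0) (t : ℝ)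
    (ht : t ≠ 0) : Tendsto (fun ε : ℝ => (2 * t / ε) • ξ) (nhdsWithin 0 (Set.Ioi 0))
      (cocompact (EuclideanSpace ℝ (Fin n))) := by
  rw [← Metric.cobounded_eq_cocompact, ← tendsto_norm_atTop_iff_cobounded]
  have h : Tendsto (fun ε : ℝ => (|2 * t| * ‖ξ‖) * ε⁻¹) (nhdsWithin 0 (Set.Ioi 0)) atTop :=
    tendsto_inv_nhdsGT_zero.const_mul_atTop (by positivity)
  refine h.congr' ?_
  filter_upwards [self_mem_nhdsWithin] with ε hε
  have hε' : 0 < ε := hε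
  rw [norm_smul, Real.norm_eq_abs, abs_div, abs_of_pos hε']
  ring

end Helpers

/-- Lemma FTLemma: for `μ = δ_a`, `t ≠ 0` and `ξ ≠ 0`, the Fourier
transform `ℱ(μ^t_ε)(ξ) = ∫ e^{-i⟨x,ξ⟩} |u_ε(x,t)|² dx` tends to `0` as `ε → 0`;
in fact it is bounded in modulus by `(√ρ * R√ρ)(-2tξ/ε)`. -/
theorem fourier_transform_of_evolved_delta_tends_to_zero
    (n : ℕ) (ρ : EuclideanSpace ℝ (Fin n) → ℝ)
    (hρ_int : Integrable ρ) (hρ_nonneg : ∀ x, 0 ≤ ρ x)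
    (hsqrt_int : Integrable (fun x => Real.sqrt (ρ x)))
    (hρ_one : ∫ x, ρ x = 1)
    (a : EuclideanSpace ℝ (Fin n)) (t : ℝ) (ht : t ≠ 0)
    (ξ : EuclideanSpace ℝ (Fin n)) (hξ : ξ ≠ 0) :
    (∀ ε : ℝ, 0 < ε →
      ‖∫ x, Complex.exp (-Complex.I * (⟪x, ξ⟫ : ℝ)) *
          ((‖uEpsShift n ρ a ε t x‖ ^ 2 : ℝ) : ℂ)‖ ≤
        ∫ y, Real.sqrt (ρ ((-(2 * t / ε)) • ξ - y)) * Real.sqrt (ρ (-y))) ∧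
    Tendsto (fun ε : ℝ => ∫ x, Complex.exp (-Complex.I * (⟪x, ξ⟫ : ℝ)) *
        ((‖uEpsShift n ρ a ε t x‖ ^ 2 : ℝ) : ℂ))
      (nhdsWithin 0 (Set.Ioi 0)) (nhds 0) := by
  have hB : ∀ ε : ℝ, 0 < ε →
      ‖∫ x, Complex.exp (-Complex.I * (⟪x, ξ⟫ : ℝ)) *
          ((‖uEpsShift n ρ a ε t x‖ ^ 2 : ℝ) : ℂ)‖ ≤
        ∫ z, Real.sqrt (ρ z) * Real.sqrt (ρ (z + (2 * t / ε) • ξ)) := fun ε hε =>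
    bound_aux n ρ hρ_int hρ_nonneg hsqrt_int a t ht ξ ε hε
  refine ⟨fun ε hε => ?_, ?_⟩
  · refine (hB ε hε).trans (le_of_eq ?_)
    rw [neg_smul]
    exact (rhs_eq_corr (fun x => Real.sqrt (ρ x)) ((2 * t / ε) • ξ)).symm
  · have h2 : MemLp (fun x => Real.sqrt (ρ x)) 2 := by
      apply memLp_two_of_sq _ hsqrt_int
      simpa only [Real.sq_sqrt (hρ_nonneg _)] using hρ_int
    have hT := (tendsto_corr _ hsqrt_int h2).comp (tendsto_smul_cocompact ξ hξ t ht)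
    refine squeeze_zero_norm' ?_ hT
    filter_upwards [self_mem_nhdsWithin] with ε hε
    exact hB ε hε
end
end
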